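/- arXiv:math/0407488 — 4 statements merged into one kernel-verified Lean document; each statement's English description precedes it below -/
import Mathlib

section
/- (a) Let C be a coalgebra over ℂ and ψ: C → ℂ a linear functional. Then for every c ∈ C the exponential series Σ_{n≥0} ψ^{⋆n}(c)/n! is summable in ℂ, where ψ^{⋆n} denotes the n-fold convolution power (ψ^{⋆0} = ε, the counit). (b) Let (φ_t)_{t≥0} be a convolution semigroup of linear functionals on C, i.e. φ_0 = ε, φ_s ⋆ φ_t = φ_{s+t} for all s,t ≥ 0, and lim_{t↘0} φ_t(c) = ε(c) for every c ∈ C. Then for every c ∈ C the limit L(c) = lim_{t↘0} (φ_t(c) − ε(c))/t exists, and moreover φ_t(c) = Σ_{n≥0} tⁿ L^{⋆n}(c)/n! for all t ≥ 0. -/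
open scoped TensorProduct

/-- The convolution of two linear functionals on a coalgebra over `ℂ`:
`φ ⋆ ψ = (φ ⊗ ψ) ∘ Δ`. -/
noncomputable def conv {C : Type*} [AddCommGroup C] [Module ℂ C] [Coalgebra ℂ C]
    (φ ψ : C →ₗ[ℂ] ℂ) : C →ₗ[ℂ] ℂ :=
  LinearMap.mul' ℂ ℂ ∘ₗ TensorProduct.map φ ψ ∘ₗ Coalgebra.comul

/-- Convolution powers of a linear functional: `ψ^{⋆0} = ε`, `ψ^{⋆(n+1)} = ψ^{⋆n} ⋆ ψ`. -/
noncomputable def convPow {C : Type*} [AddCommGroup C] [Module ℂ C] [Coalgebra ℂ C]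
    (ψ : C →ₗ[ℂ] ℂ) : ℕ → (C →ₗ[ℂ] ℂ)
  | 0 => Coalgebra.counit
  | n + 1 => conv (convPow ψ n) ψ

section NormedAlgebra

open Filter Topology Set MeasureTheory

variable {𝔸 : Type*} [NormedRing 𝔸] [CompleteSpace 𝔸]

/-- A one-parameter semigroup in a complete normed ring that is right-continuous at `0`
is continuous. -/
theorem continuousOn_of_semigroup {F : ℝ → 𝔸}
    (hadd : ∀ s t, 0 ≤ s → 0 ≤ t → F s * F t = F (s + t))
    (hlim : Tendsto F (𝓝[>] 0) (𝓝 1)) : ContinuousOn F (Ici 0) := by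
  have hright : ∀ t, 0 ≤ t → ContinuousWithinAt F (Ioi t) t := by
    intro t ht
    have hsub : Tendsto (fun s => s - t) (𝓝[>] t) (𝓝[>] 0) := by
      refine tendsto_nhdsWithin_iff.2 ⟨?_, ?_⟩
      · exact ((continuous_id.sub continuous_const).tendsto' t 0 (by simp)).mono_left
          nhdsWithin_le_nhds
      · filter_upwards [self_mem_nhdsWithin] with s hs
        exact sub_pos.2 (mem_Ioi.1 hs)
    have := (hlim.comp hsub).const_mul (F t)
    rw [mul_one] at this
    refine this.congr' ?_
    filter_upwards [self_mem_nhdsWithin] with s hs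
    have hs' : t < s := hs
    simp [hadd t (s - t) ht (sub_nonneg.2 hs'.le)]
  intro t ht
  rcases eq_or_lt_of_le (show (0 : ℝ) ≤ t from ht) with rfl | hpos
  · exact continuousWithinAt_Ioi_iff_Ici.1 (hright 0 le_rfl)
  refine (continuousAt_iff_continuous_left'_right'.2 ⟨?_, hright t ht⟩).continuousWithinAt
  have hsub : Tendsto (fun s => t - s) (𝓝[<] t) (𝓝[>] 0) := by
    refine tendsto_nhdsWithin_iff.2 ⟨?_, ?_⟩
    · exact ((continuous_const.sub continuous_id).tendsto' t 0 (by simp)).mono_left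
        nhdsWithin_le_nhds
    · filter_upwards [self_mem_nhdsWithin] with s hs
      exact sub_pos.2 (mem_Iio.1 hs)
  have hF := hlim.comp hsub
  have hinv : Tendsto Ring.inverse (𝓝 (1 : 𝔸)) (𝓝 1) := by
    simpa [ContinuousAt] using NormedRing.inverse_continuousAt (1 : 𝔸ˣ)
  have hlim' := (hinv.comp hF).const_mul (F t)
  rw [mul_one] at hlim'
  refine hlim'.congr' ?_
  filter_upwards [self_mem_nhdsWithin, nhdsWithin_le_nhds (lt_mem_nhds hpos),
    hF.eventually (Units.isOpen.mem_nhds isUnit_one)] with s hs hs0 hu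
  have hs' : s < t := hs
  have hst : F t = F s * F (t - s) := by
    rw [hadd s (t - s) hs0.le (sub_nonneg.2 hs'.le), add_sub_cancel]
  have hu' : IsUnit (F (t - s)) := hu
  change F t * Ring.inverse (F (t - s)) = F s
  rw [hst, mul_assoc, Ring.mul_inverse_cancel _ hu', mul_one]

variable [NormedAlgebra ℝ 𝔸]

/-- A one-parameter semigroup in a Banach algebra that is right-continuous at `0` is differentiable,
with derivative `F t * A` for some generator `A`. -/
theorem exists_hasDerivWithinAt_of_semigroup {F : ℝ → 𝔸} (h0 : F 0 = 1)
    (hadd : ∀ s t, 0 ≤ s → 0 ≤ t → F s * F t = F (s + t))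
    (hlim : Tendsto F (𝓝[>] 0) (𝓝 1)) :
    ∃ A : 𝔸, ∀ t, 0 ≤ t → HasDerivWithinAt F (F t * A) (Ici t) t := by
  set H : ℝ → 𝔸 := fun t => F (max t 0) with hH
  have hHF : ∀ t, 0 ≤ t → H t = F t := fun t ht => by simp [hH, ht]
  have hcont : Continuous H :=
    (continuousOn_of_semigroup hadd hlim).comp_continuous (by fun_prop) fun t => le_max_right t 0
  set K : ℝ → 𝔸 := fun u => ∫ x in (0 : ℝ)..u, H x with hK
  have hderiv : ∀ t, HasDerivAt K (H t) t := fun t =>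
    (hcont.integral_hasStrictDerivAt 0 t).hasDerivAt
  obtain ⟨h, hpos, hunit⟩ : ∃ h : ℝ, 0 < h ∧ IsUnit (K h) := by
    have hslope := hasDerivAt_iff_tendsto_slope.1 (hderiv 0)
    rw [hHF 0 le_rfl, h0] at hslope
    have hev := (hslope.mono_left (nhdsWithin_mono (0 : ℝ) (s := Ioi 0)
      fun x hx => (mem_Ioi.1 hx).ne')).eventually
        (Units.isOpen.mem_nhds isUnit_one)
    obtain ⟨h, hu, hpos⟩ := (hev.and self_mem_nhdsWithin).exists
    have hpos' : 0 < h := hpos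
    refine ⟨h, hpos', ?_⟩
    have hu' : IsUnit (slope K 0 h) := hu
    have hK0 : K 0 = 0 := by simp [hK]
    rw [slope_def_module, hK0, sub_zero, sub_zero] at hu'
    have := hu'.smul (Units.mk0 h hpos'.ne')
    simpa [Units.smul_def, smul_smul, hpos'.ne'] using this
  obtain ⟨u, hu⟩ := hunit
  have hmul : ∀ t, 0 ≤ t → F t * K h = K (t + h) - K t := by
    intro t ht
    have h1 : F t * K h = ∫ x in (0 : ℝ)..h, F t * H x :=
      ((ContinuousLinearMap.mul ℝ 𝔸 (F t)).intervalIntegral_comp_comm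
        (hcont.intervalIntegrable 0 h)).symm
    have h2 : ∫ x in (0 : ℝ)..h, F t * H x = ∫ x in (0 : ℝ)..h, H (t + x) := by
      refine intervalIntegral.integral_congr fun x hx => ?_
      rw [uIcc_of_le hpos.le] at hx
      rw [hHF x hx.1, hHF _ (add_nonneg ht hx.1), hadd t x ht hx.1]
    rw [h1, h2, intervalIntegral.integral_comp_add_left, add_zero, hK,
      intervalIntegral.integral_interval_sub_left (hcont.intervalIntegrable _ _)
        (hcont.intervalIntegrable _ _)]
  have hF : ∀ t, 0 ≤ t → F t = (K (t + h) - K t) * ↑u⁻¹ := by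
    intro t ht
    rw [← hmul t ht, ← hu, Units.mul_inv_cancel_right]
  refine ⟨(F h - 1) * ↑u⁻¹, fun t ht => ?_⟩
  have hd : HasDerivAt (fun s => (K (s + h) - K s) * (↑u⁻¹ : 𝔸)) ((H (t + h) - H t) * ↑u⁻¹) t :=
    (((hderiv (t + h)).comp_add_const t h).sub (hderiv t)).mul_const _
  have hval : (H (t + h) - H t) * ↑u⁻¹ = F t * ((F h - 1) * ↑u⁻¹) := by
    rw [hHF t ht, hHF _ (add_nonneg ht hpos.le), ← hadd t h ht hpos.le, ← mul_assoc, mul_sub,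
      mul_one]
  rw [hval] at hd
  exact hd.hasDerivWithinAt.congr (fun s hs => hF s (ht.trans hs)) (hF t ht)

/-- A one-parameter semigroup in a Banach algebra that is right-continuous at `0` is
`t ↦ exp (t • A)`, where `A` is its derivative at `0`. -/
theorem exists_eq_exp_of_semigroup {F : ℝ → 𝔸} (h0 : F 0 = 1)
    (hadd : ∀ s t, 0 ≤ s → 0 ≤ t → F s * F t = F (s + t))
    (hlim : Tendsto F (𝓝[>] 0) (𝓝 1)) :
    ∃ A : 𝔸, Tendsto (fun t : ℝ => t⁻¹ • (F t - 1)) (𝓝[>] 0) (𝓝 A) ∧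
      ∀ t, 0 ≤ t → F t = NormedSpace.exp (t • A) := by
  obtain ⟨A, hA⟩ := exists_hasDerivWithinAt_of_semigroup h0 hadd hlim
  refine ⟨A, ?_, fun t ht => ?_⟩
  · have := hasDerivWithinAt_iff_tendsto_slope.1 (hA 0 le_rfl)
    simpa [slope_fun_def, h0] using this
  have hexp : ∀ s : ℝ, HasDerivAt (fun s : ℝ => NormedSpace.exp (s • (-A)))
      (-A * NormedSpace.exp (s • (-A))) s := fun s => hasDerivAt_exp_smul_const' (-A) s
  have hconst := constant_of_has_deriv_right_zero (a := 0) (b := t)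
    (f := fun s => F s * NormedSpace.exp (s • (-A)))
    (((continuousOn_of_semigroup hadd hlim).mono Icc_subset_Ici_self).mul
      fun s _ => (hexp s).continuousAt.continuousWithinAt)
    (fun s hs => by
      have := (hA s hs.1).mul (hexp s).hasDerivWithinAt
      refine this.congr_deriv ?_
      noncomm_ring) t ⟨ht, le_rfl⟩
  simp only [h0, zero_smul, NormedSpace.exp_zero, mul_one] at hconst
  have hinv : NormedSpace.exp (t • (-A)) * NormedSpace.exp (t • A) = 1 := by
    have hcomm : Commute (t • (-A)) (t • A) :=
      ((Commute.refl A).neg_left.smul_left t).smul_right t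
    let _ : NormedAlgebra ℚ 𝔸 := NormedAlgebra.restrictScalars ℚ ℝ 𝔸
    rw [← NormedSpace.exp_add_of_commute hcomm]
    simp
  calc F t = F t * (NormedSpace.exp (t • (-A)) * NormedSpace.exp (t • A)) := by rw [hinv, mul_one]
    _ = NormedSpace.exp (t • A) := by rw [← mul_assoc, hconst, one_mul]

end NormedAlgebra

section Coalgebra

open Coalgebra WithConv

variable {K C : Type*} [Field K] [AddCommGroup C] [Module K C] [Coalgebra K C]

/-- The right contraction `c ↦ ∑ ψ(c₍₂₎) c₍₁₎` of a coalgebra by a linear functional. -/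
noncomputable def Coalgebra.contractRight (ψ : C →ₗ[K] K) : C →ₗ[K] C :=
  (_root_.TensorProduct.rid K C).toLinearMap ∘ₗ ψ.lTensor C ∘ₗ comul

theorem Coalgebra.contractRight_apply (ψ : C →ₗ[K] K) {c : C} {ι : Type*}
    (r : Coalgebra.Repr K c ι) :
    contractRight ψ c = ∑ i ∈ r.index, ψ (r.right i) • r.left i := by
  simp [contractRight, ← r.eq]

theorem Coalgebra.apply_contractRight (g ψ : C →ₗ[K] K) (c : C) :
    g (contractRight ψ c) = (toConv g * toConv ψ).ofConv c := by
  have h := (ℛ K c).convMul_apply (toConv g) (toConv ψ)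
  refine Eq.trans ?_ h.symm
  simp [contractRight_apply ψ (ℛ K c), mul_comm]

theorem Coalgebra.contractRight_one :
    contractRight (1 : WithConv (C →ₗ[K] K)).ofConv = LinearMap.id := by
  ext c
  refine Module.eval_apply_injective K (LinearMap.ext fun g => ?_)
  change g _ = g _
  rw [apply_contractRight]
  simp

theorem Coalgebra.contractRight_mul (f g : WithConv (C →ₗ[K] K)) :
    contractRight (f * g).ofConv = contractRight f.ofConv ∘ₗ contractRight g.ofConv := by
  ext c
  refine Module.eval_apply_injective K (LinearMap.ext fun e => ?_)
  change e _ = e (contractRight _ (contractRight _ c))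
  rw [apply_contractRight, apply_contractRight, apply_contractRight]
  simp [mul_assoc]

/-- Local finiteness of coalgebras, in dual form: evaluation at an element of a coalgebra factors
through a matrix representation of the convolution algebra whose coefficients are evaluations. -/
theorem Coalgebra.exists_matrix_representation (c : C) :
    ∃ (d : ℕ) (ρ : WithConv (C →ₗ[K] K) →* Matrix (Fin d) (Fin d) K)
      (l : Matrix (Fin d) (Fin d) K →ₗ[K] K) (x : Fin d → Fin d → C),
      (∀ ψ i j, ρ ψ i j = ψ.ofConv (x i j)) ∧ ∀ ψ, ψ.ofConv c = l (ρ ψ) := by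
  let V : Submodule K C :=
    Submodule.span K (Set.range fun ψ : C →ₗ[K] K => contractRight ψ c)
  have hfin : FiniteDimensional K V := by
    let r := ℛ K c
    have hle : V ≤ Submodule.span K (r.left '' (r.index : Set _)) := by
      refine Submodule.span_le.2 ?_
      rintro _ ⟨ψ, rfl⟩
      change contractRight ψ c ∈ _
      rw [contractRight_apply ψ r]
      exact Submodule.sum_mem _ fun i hi =>
        Submodule.smul_mem _ _ (Submodule.subset_span ⟨i, hi, rfl⟩)
    have : FiniteDimensional K (Submodule.span K (r.left '' (r.index : Set _))) :=
      FiniteDimensional.span_of_finite K (r.index.finite_toSet.image _)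
    exact Submodule.finiteDimensional_of_le hle
  have hc : c ∈ V := Submodule.subset_span ⟨(1 : WithConv (C →ₗ[K] K)).ofConv, by
    change contractRight _ c = c
    rw [contractRight_one]; rfl⟩
  have hinv : ∀ ψ : C →ₗ[K] K, ∀ v ∈ V, contractRight ψ v ∈ V := by
    intro ψ v hv
    have hle : V ≤ V.comap (contractRight ψ) := by
      refine Submodule.span_le.2 ?_
      rintro _ ⟨f, rfl⟩
      refine Submodule.subset_span ⟨(toConv ψ * toConv f).ofConv, ?_⟩
      change contractRight _ c = _
      rw [contractRight_mul]
      rfl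
    exact hle hv
  let b := Module.finBasis K V
  let ρ : WithConv (C →ₗ[K] K) →* Module.End K V :=
    { toFun := fun ψ => (contractRight ψ.ofConv).restrict (hinv ψ.ofConv)
      map_one' := by
        ext v
        simp [contractRight_one]
      map_mul' := fun f g => by
        ext v
        simp [contractRight_mul] }
  have hρ : ∀ ψ v, (ρ ψ v : C) = contractRight ψ.ofConv v := fun _ _ => rfl
  choose g hg using fun i => LinearMap.exists_extend (b.coord i)
  refine ⟨Module.finrank K V, ((LinearMap.toMatrixAlgEquiv b : _ →* _)).comp ρ,
    counit ∘ₗ V.subtype ∘ₗ LinearMap.applyₗ (⟨c, hc⟩ : V) ∘ₗ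
      (LinearMap.toMatrixAlgEquiv b).symm.toLinearMap,
    fun i j => TensorProduct.lid K C ((g i).rTensor C (comul (b j : C))), fun ψ i j => ?_,
    fun ψ => ?_⟩
  · have h1 : b.coord i (ρ ψ (b j)) = g i (contractRight ψ.ofConv (b j : C)) := by
      rw [← hg i, ← hρ]
      rfl
    have h2 : g i (contractRight ψ.ofConv (b j : C)) =
        ψ.ofConv (TensorProduct.lid K C ((g i).rTensor C (comul (b j : C)))) := by
      rw [contractRight_apply _ (ℛ K (b j : C)), ← (ℛ K (b j : C)).eq]
      simp [mul_comm]
    simpa [LinearMap.toMatrixAlgEquiv_apply] using h1.trans h2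
  · have h : counit (R := K) (contractRight ψ.ofConv c) = ψ.ofConv c := by
      have h1 := apply_contractRight (counit : C →ₗ[K] K) ψ.ofConv c
      have h2 : (toConv (counit : C →ₗ[K] K)) = 1 := by ext; simp
      rw [h1, h2]
      simp
    simp [hρ, h]

end Coalgebra

theorem toConv_conv {C : Type*} [AddCommGroup C] [Module ℂ C] [Coalgebra ℂ C] (φ ψ : C →ₗ[ℂ] ℂ) :
    WithConv.toConv (conv φ ψ) = WithConv.toConv φ * WithConv.toConv ψ := rfl

theorem toConv_counit {C : Type*} [AddCommGroup C] [Module ℂ C] [Coalgebra ℂ C] :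
    WithConv.toConv (Coalgebra.counit : C →ₗ[ℂ] ℂ) = 1 := by
  ext
  simp

theorem toConv_convPow {C : Type*} [AddCommGroup C] [Module ℂ C] [Coalgebra ℂ C] (ψ : C →ₗ[ℂ] ℂ)
    (n : ℕ) : WithConv.toConv (convPow ψ n) = WithConv.toConv ψ ^ n := by
  induction n with
  | zero => rw [pow_zero, convPow, toConv_counit]
  | succ n ih => rw [pow_succ, convPow, toConv_conv, ih]

open scoped Matrix.Norms.Operator in
/-- A linear functional of the exponential of a complex matrix, as a power series in time. -/
theorem hasSum_apply_exp_smul {d : ℕ} (l : Matrix (Fin d) (Fin d) ℂ →ₗ[ℂ] ℂ)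
    (A : Matrix (Fin d) (Fin d) ℂ) (t : ℝ) :
    HasSum (fun n : ℕ => (t : ℂ) ^ n * l (A ^ n) / (n.factorial : ℂ))
      (l (NormedSpace.exp (t • A))) := by
  have h := (NormedSpace.exp_series_hasSum_exp' (𝕂 := ℂ) ((t : ℂ) • A)).mapL
    (LinearMap.toContinuousLinearMap l)
  rw [show t • A = (t : ℂ) • A from (Complex.coe_smul t A).symm]
  refine h.congr_fun fun n => ?_
  simp [smul_pow]
  ring

/-- (a) For any linear functional `ψ` on a coalgebra `C` over `ℂ` and any `c ∈ C`, the
exponential series `Σ_{n ≥ 0} ψ^{⋆n}(c)/n!` is summable.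
(b) If `(φ_t)_{t ≥ 0}` is a convolution semigroup of linear functionals on `C`, then for
every `c` the limit `L(c) = lim_{t ↘ 0} (φ_t(c) - ε(c))/t` exists, and
`φ_t(c) = Σ_{n ≥ 0} tⁿ L^{⋆n}(c)/n!` for all `t ≥ 0`. -/
theorem convolution_exponential_and_semigroup_generator
    {C : Type*} [AddCommGroup C] [Module ℂ C] [Coalgebra ℂ C]
    (φ : ℝ → (C →ₗ[ℂ] ℂ))
    (hφ0 : φ 0 = Coalgebra.counit)
    (hφsg : ∀ s t : ℝ, 0 ≤ s → 0 ≤ t → conv (φ s) (φ t) = φ (s + t))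
    (hφcont : ∀ c : C, Filter.Tendsto (fun t : ℝ => φ t c)
      (nhdsWithin 0 (Set.Ioi 0)) (nhds (Coalgebra.counit (R := ℂ) c))) :
    (∀ (ψ : C →ₗ[ℂ] ℂ) (c : C),
        Summable fun n : ℕ => convPow ψ n c / (n.factorial : ℂ)) ∧
    ∃ L : C →ₗ[ℂ] ℂ,
      (∀ c : C, Filter.Tendsto
          (fun t : ℝ => (φ t c - Coalgebra.counit (R := ℂ) c) / (t : ℂ))
          (nhdsWithin 0 (Set.Ioi 0)) (nhds (L c))) ∧
      ∀ t : ℝ, 0 ≤ t → ∀ c : C,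
        HasSum (fun n : ℕ => (t : ℂ) ^ n * convPow L n c / (n.factorial : ℂ)) (φ t c) := by
  open scoped Matrix.Norms.Operator in
  open WithConv Filter Topology in
  have key : ∀ c : C, ∃ a : ℂ,
      Tendsto (fun t : ℝ => (φ t c - Coalgebra.counit (R := ℂ) c) / (t : ℂ)) (𝓝[>] 0) (𝓝 a) ∧
      ∀ L : C →ₗ[ℂ] ℂ,
        (∀ x : C, Tendsto (fun t : ℝ => (φ t x - Coalgebra.counit (R := ℂ) x) / (t : ℂ))
          (𝓝[>] 0) (𝓝 (L x))) →
        ∀ t : ℝ, 0 ≤ t →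
          HasSum (fun n : ℕ => (t : ℂ) ^ n * convPow L n c / (n.factorial : ℂ)) (φ t c) := by
    intro c
    obtain ⟨d, ρ, l, x, hρ, hl⟩ := Coalgebra.exists_matrix_representation (K := ℂ) c
    have hone : ∀ i j, (1 : Matrix (Fin d) (Fin d) ℂ) i j = Coalgebra.counit (R := ℂ) (x i j) := by
      intro i j
      rw [← map_one ρ, hρ, ← toConv_counit]
    obtain ⟨A, hA, hexp⟩ := exists_eq_exp_of_semigroup (F := fun t => ρ (toConv (φ t)))
      (by rw [hφ0, toConv_counit, map_one])
      (fun s t hs ht => by rw [← map_mul, ← toConv_conv, hφsg s t hs ht])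
      (tendsto_pi_nhds.2 fun i => tendsto_pi_nhds.2 fun j => by
        simpa only [hρ, hone, ofConv_toConv] using hφcont (x i j))
    have hlc : Continuous l := l.continuous_of_finiteDimensional
    refine ⟨l A, ?_, fun L hL t ht => ?_⟩
    · refine ((hlc.tendsto A).comp hA).congr fun t => ?_
      have h1 : l (ρ (toConv (φ t))) = φ t c := (hl (toConv (φ t))).symm
      have h2 : l 1 = Coalgebra.counit (R := ℂ) c := by
        rw [← map_one ρ, ← hl, ← toConv_counit]
      rw [Function.comp_apply, ← Complex.coe_smul, map_smul, map_sub, h1, h2, Complex.ofReal_inv,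
        smul_eq_mul, inv_mul_eq_div]
    · have hAL : ρ (toConv L) = A := by
        ext i j
        have hij := tendsto_pi_nhds.1 (tendsto_pi_nhds.1 hA i) j
        rw [hρ]
        refine tendsto_nhds_unique (hL (x i j)) (hij.congr fun t => ?_)
        rw [Matrix.smul_apply, Matrix.sub_apply, hρ, hone, ← Complex.coe_smul, Complex.ofReal_inv,
          smul_eq_mul, inv_mul_eq_div]
      have h := hasSum_apply_exp_smul l A t
      rw [show NormedSpace.exp (t • A) = ρ (toConv (φ t)) from (hexp t ht).symm, ← hl] at h
      refine h.congr_fun fun n => ?_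
      rw [← hAL, ← map_pow, ← hl, ← toConv_convPow]
  refine ⟨fun ψ c => ?_, ?_⟩
  · obtain ⟨d, ρ, l, x, hρ, hl⟩ := Coalgebra.exists_matrix_representation (K := ℂ) c
    have h := (hasSum_apply_exp_smul l (ρ (WithConv.toConv ψ)) 1).summable
    refine h.congr fun n => ?_
    rw [← map_pow, ← hl, ← toConv_convPow]
    simp
  · choose a ha hsum using key
    let L := linearMapOfTendsto (l := nhdsWithin (0 : ℝ) (Set.Ioi 0)) a
      (fun t : ℝ => (t : ℂ)⁻¹ • (φ t - Coalgebra.counit)) (tendsto_pi_nhds.2 fun c => by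
        simpa [inv_mul_eq_div] using ha c)
    exact ⟨L, ha, fun t ht c => hsum c L ha t ht⟩
end

section
/- Let B be a unital *-algebra over ℂ and Ψ: B ⊗ B → B ⊗ B a linear bijection such that B ⊗ B, equipped with the multiplication (m ⊗ m) ∘ (id ⊗ Ψ ⊗ id) and unit 1 ⊗ 1, is a unital associative algebra, and such that there is a conjugate-linear involution ⋆ on B ⊗ B determined by (a ⊗ b)⋆ = Ψ(b* ⊗ a*). Let Δ: B → B ⊗ B be a unital algebra homomorphism for this multiplication satisfying Δ(a*) = (Δ a)⋆ for all a ∈ B. Let φ, θ: B → ℂ be positive linear functionals, i.e. φ(b* b) and θ(b* b) are nonnegative reals for all b ∈ B. If (φ ⊗ id_B) ∘ Ψ = id_B ⊗ φ as maps B ⊗ B → B (using the canonical identifications ℂ ⊗ B ≅ B ≅ B ⊗ ℂ), or if (id_B ⊗ θ) ∘ Ψ = θ ⊗ id_B, then the convolution φ ⋆ θ = (φ ⊗ θ) ∘ Δ is also positive: (φ ⋆ θ)(b* b) is a nonnegative real for every b ∈ B. -/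
open scoped TensorProduct ComplexOrder

/-- The conjugate-linear map `B ⊗ B → B ⊗ B`, `a ⊗ b ↦ b* ⊗ a*`. -/
noncomputable def starSwap (B : Type*) [AddCommGroup B] [Module ℂ B]
    [StarAddMonoid B] [StarModule ℂ B] :
    B ⊗[ℂ] B →+ B ⊗[ℂ] B :=
  TensorProduct.liftAddHom
    { toFun := fun a =>
        { toFun := fun b => star b ⊗ₜ[ℂ] star a
          map_zero' := by simp
          map_add' := fun b₁ b₂ => by simp [star_add, TensorProduct.add_tmul]
        }
      map_zero' := by ext b; simp
      map_add' := fun a₁ a₂ => by ext b; simp [star_add, TensorProduct.tmul_add]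
    }
    (fun c a b => by
      simp only [AddMonoidHom.coe_mk, ZeroHom.coe_mk, star_smul]
      exact (TensorProduct.smul_tmul _ _ _).symm)

/-- The multiplication `(m ⊗ m) ∘ (id ⊗ Ψ ⊗ id)` on `B ⊗ B` twisted by a braiding `Ψ`:
`(a ⊗ b)·(c ⊗ d) = Σ (a xᵢ) ⊗ (yᵢ d)` where `Ψ(b ⊗ c) = Σ xᵢ ⊗ yᵢ`. -/
noncomputable def mulPsi {B : Type*} [Ring B] [Algebra ℂ B]
    (Ψ : B ⊗[ℂ] B →ₗ[ℂ] B ⊗[ℂ] B) :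
    (B ⊗[ℂ] B) ⊗[ℂ] (B ⊗[ℂ] B) →ₗ[ℂ] B ⊗[ℂ] B :=
  TensorProduct.map (LinearMap.mul' ℂ B) (LinearMap.mul' ℂ B)
    ∘ₗ (TensorProduct.assoc ℂ (B ⊗[ℂ] B) B B).toLinearMap
    ∘ₗ TensorProduct.map
        ((TensorProduct.assoc ℂ B B B).symm.toLinearMap
          ∘ₗ TensorProduct.map LinearMap.id Ψ
          ∘ₗ (TensorProduct.assoc ℂ B B B).toLinearMap) LinearMap.id
    ∘ₗ (TensorProduct.assoc ℂ (B ⊗[ℂ] B) B B).symm.toLinearMap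

@[simp]
theorem starSwap_tmul {B : Type*} [AddCommGroup B] [Module ℂ B]
    [StarAddMonoid B] [StarModule ℂ B] (a b : B) :
    starSwap B (a ⊗ₜ[ℂ] b) = star b ⊗ₜ[ℂ] star a := rfl

theorem starSwap_starSwap {B : Type*} [AddCommGroup B] [Module ℂ B]
    [StarAddMonoid B] [StarModule ℂ B] (x : B ⊗[ℂ] B) :
    starSwap B (starSwap B x) = x := by
  induction x with
  | zero => simp
  | tmul a b => simp
  | add x y hx hy => simp [hx, hy]

section TwistedMultiplication

variable {B : Type*} [Ring B] [Algebra ℂ B] (Ψ : B ⊗[ℂ] B →ₗ[ℂ] B ⊗[ℂ] B)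

theorem mulPsi_tmul_tmul (a b c d : B) :
    mulPsi Ψ ((a ⊗ₜ[ℂ] b) ⊗ₜ[ℂ] (c ⊗ₜ[ℂ] d))
      = TensorProduct.map (LinearMap.mulLeft ℂ a) (LinearMap.mulRight ℂ d)
          (Ψ (b ⊗ₜ[ℂ] c)) := by
  simp only [mulPsi, LinearMap.comp_apply, LinearEquiv.coe_coe, TensorProduct.assoc_symm_tmul,
    TensorProduct.map_tmul, TensorProduct.assoc_tmul, LinearMap.id_apply]
  induction Ψ (b ⊗ₜ[ℂ] c) with
  | zero => simp
  | tmul x y => simp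
  | add x y hx hy => simp only [TensorProduct.tmul_add, map_add, TensorProduct.add_tmul, hx, hy]

theorem mulPsi_one_tmul_tmul_one (b c : B) :
    mulPsi Ψ ((1 ⊗ₜ[ℂ] b) ⊗ₜ[ℂ] (c ⊗ₜ[ℂ] 1)) = Ψ (b ⊗ₜ[ℂ] c) := by
  simp [mulPsi_tmul_tmul]

variable {Ψ}

theorem braiding_one_tmul
    (h : ∀ x : B ⊗[ℂ] B, mulPsi Ψ (((1 : B) ⊗ₜ[ℂ] (1 : B)) ⊗ₜ[ℂ] x) = x) (c : B) :
    Ψ (1 ⊗ₜ[ℂ] c) = c ⊗ₜ[ℂ] 1 := by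
  rw [← mulPsi_one_tmul_tmul_one, h]

theorem braiding_tmul_one
    (h : ∀ x : B ⊗[ℂ] B, mulPsi Ψ (x ⊗ₜ[ℂ] ((1 : B) ⊗ₜ[ℂ] (1 : B))) = x) (b : B) :
    Ψ (b ⊗ₜ[ℂ] 1) = 1 ⊗ₜ[ℂ] b := by
  rw [← mulPsi_one_tmul_tmul_one, h]

theorem mulPsi_braiding_tmul
    (hassoc : ∀ x y z : B ⊗[ℂ] B,
      mulPsi Ψ (mulPsi Ψ (x ⊗ₜ[ℂ] y) ⊗ₜ[ℂ] z) = mulPsi Ψ (x ⊗ₜ[ℂ] mulPsi Ψ (y ⊗ₜ[ℂ] z)))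
    (hone : ∀ x : B ⊗[ℂ] B, mulPsi Ψ (((1 : B) ⊗ₜ[ℂ] (1 : B)) ⊗ₜ[ℂ] x) = x)
    (a b c d : B) :
    mulPsi Ψ (Ψ (b ⊗ₜ[ℂ] a) ⊗ₜ[ℂ] (c ⊗ₜ[ℂ] d))
      = TensorProduct.map LinearMap.id (LinearMap.mulRight ℂ d) (Ψ (b ⊗ₜ[ℂ] (a * c))) := by
  rw [← mulPsi_one_tmul_tmul_one Ψ b a, hassoc, mulPsi_tmul_tmul Ψ a, braiding_one_tmul hone]
  simp [mulPsi_tmul_tmul]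

theorem mulPsi_tmul_braiding
    (hassoc : ∀ x y z : B ⊗[ℂ] B,
      mulPsi Ψ (mulPsi Ψ (x ⊗ₜ[ℂ] y) ⊗ₜ[ℂ] z) = mulPsi Ψ (x ⊗ₜ[ℂ] mulPsi Ψ (y ⊗ₜ[ℂ] z)))
    (hone : ∀ x : B ⊗[ℂ] B, mulPsi Ψ (x ⊗ₜ[ℂ] ((1 : B) ⊗ₜ[ℂ] (1 : B))) = x)
    (a b c d : B) :
    mulPsi Ψ ((a ⊗ₜ[ℂ] b) ⊗ₜ[ℂ] Ψ (c ⊗ₜ[ℂ] d))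
      = TensorProduct.map (LinearMap.mulLeft ℂ a) LinearMap.id (Ψ ((b * c) ⊗ₜ[ℂ] d)) := by
  rw [← mulPsi_one_tmul_tmul_one Ψ c d, ← hassoc, mulPsi_tmul_tmul Ψ a, braiding_tmul_one hone]
  simp [mulPsi_tmul_tmul]

end TwistedMultiplication

section Functionals

variable {B : Type*} [Ring B] [Algebra ℂ B]

theorem mul_map_mulRight (φ θ : B →ₗ[ℂ] ℂ) (d : B) (x : B ⊗[ℂ] B) :
    LinearMap.mul' ℂ ℂ (TensorProduct.map φ θ
        (TensorProduct.map LinearMap.id (LinearMap.mulRight ℂ d) x))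
      = θ (TensorProduct.lid ℂ B (TensorProduct.map φ LinearMap.id x) * d) := by
  induction x with
  | zero => simp
  | tmul a b => simp
  | add x y hx hy => simp only [map_add, add_mul, hx, hy]

theorem mul_map_mulLeft (φ θ : B →ₗ[ℂ] ℂ) (a : B) (x : B ⊗[ℂ] B) :
    LinearMap.mul' ℂ ℂ (TensorProduct.map φ θ
        (TensorProduct.map (LinearMap.mulLeft ℂ a) LinearMap.id x))
      = φ (a * TensorProduct.rid ℂ B (TensorProduct.map LinearMap.id θ x)) := by
  induction x with
  | zero => simp
  | tmul b c => simp [mul_comm]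
  | add x y hx hy => simp only [map_add, mul_add, hx, hy]

variable [StarRing B] [StarModule ℂ B]

theorem star_apply_star_mul_of_nonneg {φ : B →ₗ[ℂ] ℂ} (hφ : ∀ b : B, 0 ≤ φ (star b * b))
    (a b : B) : star (φ (star a * b)) = φ (star b * a) := by
  have ha := (Complex.nonneg_iff.mp (hφ a)).2
  have hb := (Complex.nonneg_iff.mp (hφ b)).2
  have h₁ := (Complex.nonneg_iff.mp (hφ (a + b))).2
  have h₂ := (Complex.nonneg_iff.mp (hφ (a + Complex.I • b))).2
  simp [add_mul, mul_add] at h₁ h₂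
  apply Complex.ext <;> simp <;> linarith

theorem posSemidef_gram_of_nonneg {φ : B →ₗ[ℂ] ℂ} (hφ : ∀ b : B, 0 ≤ φ (star b * b))
    {ι : Type*} [Fintype ι] (a : ι → B) :
    (Matrix.of fun i j => φ (star (a i) * a j)).PosSemidef := by
  refine Matrix.PosSemidef.of_dotProduct_mulVec_nonneg ?_ fun x => ?_
  · ext i j
    exact star_apply_star_mul_of_nonneg hφ _ _
  · convert hφ (∑ i, x i • a i) using 1
    rw [star_sum, Finset.sum_mul_sum]
    simp only [dotProduct, Matrix.mulVec, Matrix.of_apply, Pi.star_apply, star_smul, map_sum,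
      Finset.mul_sum, smul_mul_smul_comm, map_smul, smul_eq_mul]
    exact Finset.sum_congr rfl fun i _ => Finset.sum_congr rfl fun j _ => by ring

theorem sum_mul_nonneg_of_nonneg {φ θ : B →ₗ[ℂ] ℂ} (hφ : ∀ b : B, 0 ≤ φ (star b * b))
    (hθ : ∀ b : B, 0 ≤ θ (star b * b)) {ι : Type*} [Fintype ι] (a b : ι → B) :
    0 ≤ ∑ i, ∑ j, φ (star (a i) * a j) * θ (star (b i) * b j) := by
  have h := ((posSemidef_gram_of_nonneg hφ a).hadamard
    (posSemidef_gram_of_nonneg hθ b)).dotProduct_mulVec_nonneg 1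
  simpa [dotProduct, Matrix.mulVec] using h

end Functionals

/-- If `B ⊗ B` with the `Ψ`-twisted multiplication and the involution
`(a ⊗ b)⋆ = Ψ(b* ⊗ a*)` is a unital `*`-algebra, `Δ : B → B ⊗ B` is a unital algebra
homomorphism intertwining the stars, and `φ, θ` are positive functionals on `B` with
`φ` `Ψ`-invariant or `θ` `Ψ⁻¹`-invariant, then the convolution
`φ ⋆ θ = (φ ⊗ θ) ∘ Δ` is positive. -/
theorem braided_convolution_of_positive_is_positive
    {B : Type*} [Ring B] [Algebra ℂ B] [StarRing B] [StarModule ℂ B]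
    (Ψ : B ⊗[ℂ] B ≃ₗ[ℂ] B ⊗[ℂ] B)
    (hmul_assoc : ∀ x y z : B ⊗[ℂ] B,
      mulPsi Ψ.toLinearMap (mulPsi Ψ.toLinearMap (x ⊗ₜ[ℂ] y) ⊗ₜ[ℂ] z)
        = mulPsi Ψ.toLinearMap (x ⊗ₜ[ℂ] mulPsi Ψ.toLinearMap (y ⊗ₜ[ℂ] z)))
    (hmul_one : ∀ x : B ⊗[ℂ] B,
      mulPsi Ψ.toLinearMap (((1 : B) ⊗ₜ[ℂ] (1 : B)) ⊗ₜ[ℂ] x) = x ∧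
      mulPsi Ψ.toLinearMap (x ⊗ₜ[ℂ] ((1 : B) ⊗ₜ[ℂ] (1 : B))) = x)
    (hstar_invol : ∀ x : B ⊗[ℂ] B, Ψ (starSwap B (Ψ (starSwap B x))) = x)
    (Δ : B →ₗ[ℂ] B ⊗[ℂ] B)
    (hΔone : Δ 1 = (1 : B) ⊗ₜ[ℂ] (1 : B))
    (hΔmul : ∀ a b : B, Δ (a * b) = mulPsi Ψ.toLinearMap (Δ a ⊗ₜ[ℂ] Δ b))
    (hΔstar : ∀ a : B, Δ (star a) = Ψ (starSwap B (Δ a)))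
    (φ θ : B →ₗ[ℂ] ℂ)
    (hφpos : ∀ b : B, 0 ≤ φ (star b * b))
    (hθpos : ∀ b : B, 0 ≤ θ (star b * b))
    (hinv :
      ((TensorProduct.lid ℂ B).toLinearMap ∘ₗ TensorProduct.map φ LinearMap.id)
          ∘ₗ Ψ.toLinearMap
        = (TensorProduct.rid ℂ B).toLinearMap ∘ₗ TensorProduct.map LinearMap.id φ
      ∨ ((TensorProduct.rid ℂ B).toLinearMap ∘ₗ TensorProduct.map LinearMap.id θ)
          ∘ₗ Ψ.toLinearMap
        = (TensorProduct.lid ℂ B).toLinearMap ∘ₗ TensorProduct.map θ LinearMap.id) :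
    ∀ b : B,
      0 ≤ (LinearMap.mul' ℂ ℂ ∘ₗ TensorProduct.map φ θ ∘ₗ Δ) (star b * b) := by
  intro b
  have hone_left := fun x => (hmul_one x).1
  have hone_right := fun x => (hmul_one x).2
  simp only [LinearMap.comp_apply, hΔmul, hΔstar]
  rcases hinv with hφinv | hθinv
  · obtain ⟨k, a, c, hx⟩ := TensorProduct.exists_sum_tmul_eq (Δ b)
    convert sum_mul_nonneg_of_nonneg hφpos hθpos a c using 1
    simp only [hx, map_sum, starSwap_tmul, TensorProduct.sum_tmul, TensorProduct.tmul_sum]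
    rw [Finset.sum_comm]
    refine Finset.sum_congr rfl fun i _ => Finset.sum_congr rfl fun j _ => ?_
    have hinv := LinearMap.congr_fun hφinv (star (c i) ⊗ₜ[ℂ] (star (a i) * a j))
    simp only [LinearMap.comp_apply, LinearEquiv.coe_coe] at hinv
    have hmul := mulPsi_braiding_tmul hmul_assoc hone_left (star (a i)) (star (c i)) (a j) (c j)
    simp only [LinearEquiv.coe_coe] at hmul
    rw [hmul, mul_map_mulRight, hinv]
    simp
  · obtain ⟨k, c, a, hx⟩ := TensorProduct.exists_sum_tmul_eq (Ψ.symm (Δ b))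
    have hstar : Ψ (starSwap B (Δ b)) = starSwap B (Ψ.symm (Δ b)) := by
      have h := hstar_invol (starSwap B (Ψ.symm (Δ b)))
      rwa [starSwap_starSwap, Ψ.apply_symm_apply] at h
    have hΔ : Δ b = Ψ (∑ j, c j ⊗ₜ[ℂ] a j) := by rw [← hx, Ψ.apply_symm_apply]
    convert sum_mul_nonneg_of_nonneg hφpos hθpos a c using 1
    rw [hstar, hx, hΔ]
    simp only [map_sum, starSwap_tmul, TensorProduct.sum_tmul, TensorProduct.tmul_sum]
    rw [Finset.sum_comm]
    refine Finset.sum_congr rfl fun i _ => Finset.sum_congr rfl fun j _ => ?_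
    have hinv := LinearMap.congr_fun hθinv ((star (c i) * c j) ⊗ₜ[ℂ] a j)
    simp only [LinearMap.comp_apply, LinearEquiv.coe_coe] at hinv
    have hmul := mulPsi_tmul_braiding hmul_assoc hone_right (star (a i)) (star (c i)) (c j) (a j)
    simp only [LinearEquiv.coe_coe] at hmul
    rw [hmul, mul_map_mulLeft, hinv]
    simp [mul_comm]
end

section
/- Let A be a Hopf algebra over ℂ whose antipode S is bijective with inverse S⁻¹, let V and W be complex vector spaces, let α: A ⊗ W → W be a left action of A on W, and let γ: V → A ⊗ V be a left coaction of A on V. Then the linear map Ψ = (α ⊗ id_V) ∘ (id_A ⊗ τ_{V,W}) ∘ (γ ⊗ id_W): V ⊗ W → W ⊗ V is bijective, with inverse Ψ⁻¹ = τ_{W,V} ∘ (α ⊗ id_V) ∘ (S⁻¹ ⊗ id_W ⊗ id_V) ∘ (τ_{W,A} ⊗ id_V) ∘ (id_W ⊗ γ): W ⊗ V → V ⊗ W, where τ denotes the flip of tensor factors. -/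
open scoped TensorProduct

/-- The braiding `Ψ = (α ⊗ id) ∘ (id ⊗ τ) ∘ (γ ⊗ id) : V ⊗ W → W ⊗ V` built from a left
action `α` of `A` on `W` and a left coaction `γ` of `A` on `V`. -/
noncomputable def braidPsi {A V W : Type*} [Ring A] [Algebra ℂ A]
    [AddCommGroup V] [Module ℂ V] [AddCommGroup W] [Module ℂ W]
    (α : A ⊗[ℂ] W →ₗ[ℂ] W) (γ : V →ₗ[ℂ] A ⊗[ℂ] V) :
    V ⊗[ℂ] W →ₗ[ℂ] W ⊗[ℂ] V :=
  TensorProduct.map α LinearMap.id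
    ∘ₗ (TensorProduct.assoc ℂ A W V).symm.toLinearMap
    ∘ₗ TensorProduct.map LinearMap.id (TensorProduct.comm ℂ V W).toLinearMap
    ∘ₗ (TensorProduct.assoc ℂ A V W).toLinearMap
    ∘ₗ TensorProduct.map γ LinearMap.id

/-- The candidate inverse
`Ψ⁻¹ = τ ∘ (α ⊗ id) ∘ (S⁻¹ ⊗ id ⊗ id) ∘ (τ ⊗ id) ∘ (id ⊗ γ) : W ⊗ V → V ⊗ W`. -/
noncomputable def braidPsiInv {A V W : Type*} [Ring A] [Algebra ℂ A]
    [AddCommGroup V] [Module ℂ V] [AddCommGroup W] [Module ℂ W]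
    (α : A ⊗[ℂ] W →ₗ[ℂ] W) (γ : V →ₗ[ℂ] A ⊗[ℂ] V) (S' : A →ₗ[ℂ] A) :
    W ⊗[ℂ] V →ₗ[ℂ] V ⊗[ℂ] W :=
  (TensorProduct.comm ℂ W V).toLinearMap
    ∘ₗ TensorProduct.map α LinearMap.id
    ∘ₗ TensorProduct.map (TensorProduct.map S' LinearMap.id) LinearMap.id
    ∘ₗ TensorProduct.map (TensorProduct.comm ℂ W A).toLinearMap LinearMap.id
    ∘ₗ (TensorProduct.assoc ℂ W A V).symm.toLinearMap
    ∘ₗ TensorProduct.map LinearMap.id γ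

open TensorProduct in
theorem braidPsi_tmul {A V W : Type*} [Ring A] [Algebra ℂ A]
    [AddCommGroup V] [Module ℂ V] [AddCommGroup W] [Module ℂ W]
    (α : A ⊗[ℂ] W →ₗ[ℂ] W) (γ : V →ₗ[ℂ] A ⊗[ℂ] V) (v : V) (w : W) :
    braidPsi α γ (v ⊗ₜ w) = (α ∘ₗ (mk ℂ A W).flip w).rTensor V (γ v) := by
  simp only [braidPsi, LinearMap.comp_apply, map_tmul, LinearMap.id_apply]
  induction γ v with
  | zero => simp
  | add x y hx hy => simp only [add_tmul, map_add, hx, hy]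
  | tmul a u => simp

open TensorProduct in
theorem braidPsiInv_tmul {A V W : Type*} [Ring A] [Algebra ℂ A]
    [AddCommGroup V] [Module ℂ V] [AddCommGroup W] [Module ℂ W]
    (α : A ⊗[ℂ] W →ₗ[ℂ] W) (γ : V →ₗ[ℂ] A ⊗[ℂ] V) (S' : A →ₗ[ℂ] A) (w : W) (v : V) :
    braidPsiInv α γ S' (w ⊗ₜ v) =
      TensorProduct.comm ℂ W V ((α ∘ₗ (mk ℂ A W).flip w ∘ₗ S').rTensor V (γ v)) := by
  simp only [braidPsiInv, LinearMap.comp_apply, map_tmul, LinearMap.id_apply]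
  induction γ v with
  | zero => simp
  | add x y hx hy => simp only [tmul_add, map_add, hx, hy]
  | tmul a u => simp

/-- If `h : A ⊗ A → A` satisfies `h ∘ Δ = 1 · ε`, then applying it to the first two legs of the
iterated coaction on `v` and acting on `w` gives back `w ⊗ v`. -/
theorem rTensor_action_iterated_coaction {A V W : Type*} [Ring A] [Bialgebra ℂ A]
    [AddCommGroup V] [Module ℂ V] [AddCommGroup W] [Module ℂ W]
    (α : A ⊗[ℂ] W →ₗ[ℂ] W) (hα1 : ∀ w : W, α ((1 : A) ⊗ₜ[ℂ] w) = w)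
    (γ : V →ₗ[ℂ] A ⊗[ℂ] V)
    (hγcounit : ∀ v : V,
      (TensorProduct.lid ℂ V)
        (TensorProduct.map (Coalgebra.counit (R := ℂ)) LinearMap.id (γ v)) = v)
    (hγcoassoc : ∀ v : V,
      TensorProduct.map LinearMap.id γ (γ v)
        = TensorProduct.assoc ℂ A A V
            (TensorProduct.map (Coalgebra.comul (R := ℂ)) LinearMap.id (γ v)))
    (h : A ⊗[ℂ] A →ₗ[ℂ] A)
    (hh : ∀ a : A, h (Coalgebra.comul (R := ℂ) a) = Coalgebra.counit (R := ℂ) a • (1 : A))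
    (v : V) (w : W) :
    (α ∘ₗ (TensorProduct.mk ℂ A W).flip w ∘ₗ h).rTensor V
      ((TensorProduct.assoc ℂ A A V).symm (γ.lTensor A (γ v))) = w ⊗ₜ v := by
  rw [LinearMap.lTensor, hγcoassoc, LinearEquiv.symm_apply_apply]
  conv_rhs => rw [← hγcounit v]
  induction γ v with
  | zero => simp
  | add x y hx hy => simp only [map_add, TensorProduct.tmul_add, hx, hy]
  | tmul a u => simp [hh, hα1, ← TensorProduct.smul_tmul']

/-- The inverse of the antipode is an antipode for the opposite multiplication:
`a₍₂₎ S⁻¹(a₍₁₎) = ε(a)` and `S⁻¹(a₍₂₎) a₍₁₎ = ε(a)`. -/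
theorem antipode_inverse_mul_comul {A : Type*} [Ring A] [HopfAlgebra ℂ A] (S' : A →ₗ[ℂ] A)
    (hS'l : S' ∘ₗ HopfAlgebra.antipode (R := ℂ) (A := A) = LinearMap.id)
    (hS'r : HopfAlgebra.antipode (R := ℂ) (A := A) ∘ₗ S' = LinearMap.id) (a : A) :
    ((LinearMap.mul' ℂ A ∘ₗ (TensorProduct.comm ℂ A A).toLinearMap ∘ₗ S'.lTensor A)
        (Coalgebra.comul (R := ℂ) a) = Coalgebra.counit (R := ℂ) a • (1 : A)) ∧
      (LinearMap.mul' ℂ A ∘ₗ (TensorProduct.comm ℂ A A).toLinearMap ∘ₗ S'.rTensor A)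
        (Coalgebra.comul (R := ℂ) a) = Coalgebra.counit (R := ℂ) a • (1 : A) := by
  have hr (x : A) : HopfAlgebra.antipode ℂ (S' x) = x := LinearMap.congr_fun hS'r x
  have hinj : Function.Injective (HopfAlgebra.antipode ℂ (A := A)) :=
    Function.LeftInverse.injective (g := S') (LinearMap.congr_fun hS'l)
  constructor <;> apply hinj
  · rw [map_smul, HopfAlgebra.antipode_one, ← Algebra.algebraMap_eq_smul_one,
      ← HopfAlgebra.mul_antipode_rTensor_comul_apply]
    induction Coalgebra.comul (R := ℂ) a with
    | zero => simp
    | add x y hx hy => simp only [map_add, hx, hy]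
    | tmul x y => simp [HopfAlgebra.antipode_mul_antidistrib, hr]
  · rw [map_smul, HopfAlgebra.antipode_one, ← Algebra.algebraMap_eq_smul_one,
      ← HopfAlgebra.mul_antipode_lTensor_comul_apply]
    induction Coalgebra.comul (R := ℂ) a with
    | zero => simp
    | add x y hx hy => simp only [map_add, hx, hy]
    | tmul x y => simp [HopfAlgebra.antipode_mul_antidistrib, hr]

theorem braidPsiInv_rTensor_action {A V W : Type*} [Ring A] [Algebra ℂ A]
    [AddCommGroup V] [Module ℂ V] [AddCommGroup W] [Module ℂ W]
    (S' : A →ₗ[ℂ] A) (α : A ⊗[ℂ] W →ₗ[ℂ] W)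
    (hαmul : ∀ (a b : A) (w : W), α ((a * b) ⊗ₜ[ℂ] w) = α (a ⊗ₜ[ℂ] α (b ⊗ₜ[ℂ] w)))
    (γ : V →ₗ[ℂ] A ⊗[ℂ] V) (w : W) (t : A ⊗[ℂ] V) :
    braidPsiInv α γ S' ((α ∘ₗ (TensorProduct.mk ℂ A W).flip w).rTensor V t) =
      TensorProduct.comm ℂ W V
        ((α ∘ₗ (TensorProduct.mk ℂ A W).flip w ∘ₗ
          (LinearMap.mul' ℂ A ∘ₗ (TensorProduct.comm ℂ A A).toLinearMap ∘ₗ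
            S'.lTensor A)).rTensor V
          ((TensorProduct.assoc ℂ A A V).symm (γ.lTensor A t))) := by
  induction t with
  | zero => simp
  | add x y hx hy => simp only [map_add, hx, hy]
  | tmul a u =>
    rw [LinearMap.rTensor_tmul, braidPsiInv_tmul, LinearMap.lTensor_tmul]
    induction γ u with
    | zero => simp
    | add x y hx hy => simp only [map_add, TensorProduct.tmul_add, hx, hy]
    | tmul b v => simp [hαmul]

theorem braidPsi_comm_rTensor_action {A V W : Type*} [Ring A] [Algebra ℂ A]
    [AddCommGroup V] [Module ℂ V] [AddCommGroup W] [Module ℂ W]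
    (S' : A →ₗ[ℂ] A) (α : A ⊗[ℂ] W →ₗ[ℂ] W)
    (hαmul : ∀ (a b : A) (w : W), α ((a * b) ⊗ₜ[ℂ] w) = α (a ⊗ₜ[ℂ] α (b ⊗ₜ[ℂ] w)))
    (γ : V →ₗ[ℂ] A ⊗[ℂ] V) (w : W) (t : A ⊗[ℂ] V) :
    braidPsi α γ (TensorProduct.comm ℂ W V
        ((α ∘ₗ (TensorProduct.mk ℂ A W).flip w ∘ₗ S').rTensor V t)) =
      (α ∘ₗ (TensorProduct.mk ℂ A W).flip w ∘ₗ
        (LinearMap.mul' ℂ A ∘ₗ (TensorProduct.comm ℂ A A).toLinearMap ∘ₗ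
          S'.rTensor A)).rTensor V
        ((TensorProduct.assoc ℂ A A V).symm (γ.lTensor A t)) := by
  induction t with
  | zero => simp
  | add x y hx hy => simp only [map_add, hx, hy]
  | tmul a u =>
    rw [LinearMap.rTensor_tmul, TensorProduct.comm_tmul, braidPsi_tmul, LinearMap.lTensor_tmul]
    induction γ u with
    | zero => simp
    | add x y hx hy => simp only [map_add, TensorProduct.tmul_add, hx, hy]
    | tmul b v => simp [hαmul]

/-- If the antipode of a Hopf algebra `A` over `ℂ` is bijective with inverse `S⁻¹`, then
for every left action `α` of `A` on `W` and left coaction `γ` of `A` on `V` the map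
`Ψ = (α ⊗ id) ∘ (id ⊗ τ) ∘ (γ ⊗ id) : V ⊗ W → W ⊗ V` is bijective, with inverse
`τ ∘ (α ⊗ id) ∘ (S⁻¹ ⊗ id ⊗ id) ∘ (τ ⊗ id) ∘ (id ⊗ γ)`. -/
theorem braiding_bijective
    {A V W : Type*} [Ring A] [HopfAlgebra ℂ A]
    [AddCommGroup V] [Module ℂ V] [AddCommGroup W] [Module ℂ W]
    (S' : A →ₗ[ℂ] A)
    (hS'l : S' ∘ₗ HopfAlgebra.antipode (R := ℂ) (A := A) = LinearMap.id)
    (hS'r : HopfAlgebra.antipode (R := ℂ) (A := A) ∘ₗ S' = LinearMap.id)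
    (α : A ⊗[ℂ] W →ₗ[ℂ] W)
    (hα1 : ∀ w : W, α ((1 : A) ⊗ₜ[ℂ] w) = w)
    (hαmul : ∀ (a b : A) (w : W), α ((a * b) ⊗ₜ[ℂ] w) = α (a ⊗ₜ[ℂ] α (b ⊗ₜ[ℂ] w)))
    (γ : V →ₗ[ℂ] A ⊗[ℂ] V)
    (hγcounit : ∀ v : V,
      (TensorProduct.lid ℂ V)
        (TensorProduct.map (Coalgebra.counit (R := ℂ)) LinearMap.id (γ v)) = v)
    (hγcoassoc : ∀ v : V,
      TensorProduct.map LinearMap.id γ (γ v)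
        = TensorProduct.assoc ℂ A A V
            (TensorProduct.map (Coalgebra.comul (R := ℂ)) LinearMap.id (γ v))) :
    braidPsiInv α γ S' ∘ₗ braidPsi α γ = LinearMap.id ∧
    braidPsi α γ ∘ₗ braidPsiInv α γ S' = LinearMap.id ∧
    Function.Bijective (braidPsi α γ) := by
  have hl : braidPsiInv α γ S' ∘ₗ braidPsi α γ = LinearMap.id := by
    refine TensorProduct.ext' fun v w => ?_
    rw [LinearMap.comp_apply, braidPsi_tmul, braidPsiInv_rTensor_action S' α hαmul,
      rTensor_action_iterated_coaction α hα1 γ hγcounit hγcoassoc _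
        fun a => (antipode_inverse_mul_comul S' hS'l hS'r a).1]
    simp
  have hr : braidPsi α γ ∘ₗ braidPsiInv α γ S' = LinearMap.id := by
    refine TensorProduct.ext' fun w v => ?_
    rw [LinearMap.comp_apply, braidPsiInv_tmul, braidPsi_comm_rTensor_action S' α hαmul,
      rTensor_action_iterated_coaction α hα1 γ hγcounit hγcoassoc _
        fun a => (antipode_inverse_mul_comul S' hS'l hS'r a).2]
    simp
  exact ⟨hl, hr, Function.bijective_iff_has_inverse.mpr
    ⟨braidPsiInv α γ S', fun x => LinearMap.congr_fun hl x,
      fun x => LinearMap.congr_fun hr x⟩⟩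
end

section
/- Let A be a bialgebra over ℂ equipped with a universal R-form r with convolution inverse r̄, i.e. linear functionals r, r̄ on A ⊗ A with r ⋆ r̄ = r̄ ⋆ r = ε ⊗ ε, m^op = r ⋆ m ⋆ r̄, r₁₃ ⋆ r₂₃ = r ∘ (m ⊗ id), and r₁₃ ⋆ r₁₂ = r ∘ (id ⊗ m). Let γ: V → A ⊗ V be a left coaction of A on a complex vector space V. Then: (1) α = (r̄ ⊗ id_V) ∘ (id_A ⊗ γ): A ⊗ V → V is a left action of A on V; (2) α and γ satisfy the compatibility condition (m ⊗ α) ∘ (id ⊗ τ ⊗ id) ∘ (Δ ⊗ γ) = (m ⊗ id) ∘ (id ⊗ τ) ∘ (γ ⊗ id) ∘ (α ⊗ id) ∘ (id ⊗ τ) ∘ (Δ ⊗ id) as maps A ⊗ V → A ⊗ V; (3) if W is another left A-comodule with coaction γ_W and f: V → W is a comodule map (γ_W ∘ f = (id_A ⊗ f) ∘ γ), then f is a module map for the actions defined in (1): f ∘ α_V = α_W ∘ (id_A ⊗ f). -/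
open scoped TensorProduct

section Defs

variable {A : Type*} [Ring A] [Bialgebra ℂ A]

/-- Convolution of two linear maps from a space equipped with a "comultiplication" `Δ`
into an algebra `M`: `f ⋆ g = m ∘ (f ⊗ g) ∘ Δ`. -/
noncomputable def convWith {C M : Type*} [AddCommGroup C] [Module ℂ C]
    [Ring M] [Algebra ℂ M]
    (Δ : C →ₗ[ℂ] C ⊗[ℂ] C) (f g : C →ₗ[ℂ] M) : C →ₗ[ℂ] M :=
  LinearMap.mul' ℂ M ∘ₗ TensorProduct.map f g ∘ₗ Δ

/-- The comultiplication of the tensor product coalgebra `A ⊗ A`: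
`Δ₂ = (id ⊗ τ ⊗ id) ∘ (Δ ⊗ Δ)`. -/
noncomputable def Delta2 (A : Type*) [Ring A] [Bialgebra ℂ A] :
    A ⊗[ℂ] A →ₗ[ℂ] (A ⊗[ℂ] A) ⊗[ℂ] (A ⊗[ℂ] A) :=
  (TensorProduct.tensorTensorTensorComm ℂ A A A A).toLinearMap
    ∘ₗ TensorProduct.map (Coalgebra.comul (R := ℂ)) (Coalgebra.comul (R := ℂ))

/-- The counit `ε ⊗ ε` of the tensor product coalgebra `A ⊗ A`. -/
noncomputable def counit2 (A : Type*) [Ring A] [Bialgebra ℂ A] :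
    A ⊗[ℂ] A →ₗ[ℂ] ℂ :=
  LinearMap.mul' ℂ ℂ
    ∘ₗ TensorProduct.map (Coalgebra.counit (R := ℂ)) (Coalgebra.counit (R := ℂ))

/-- The comultiplication of the triple tensor product coalgebra `(A ⊗ A) ⊗ A`. -/
noncomputable def Delta3 (A : Type*) [Ring A] [Bialgebra ℂ A] :
    (A ⊗[ℂ] A) ⊗[ℂ] A →ₗ[ℂ] ((A ⊗[ℂ] A) ⊗[ℂ] A) ⊗[ℂ] ((A ⊗[ℂ] A) ⊗[ℂ] A) :=
  (TensorProduct.tensorTensorTensorComm ℂ (A ⊗[ℂ] A) (A ⊗[ℂ] A) A A).toLinearMap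
    ∘ₗ TensorProduct.map (Delta2 A) (Coalgebra.comul (R := ℂ))

/-- `r₁₂ = r ⊗ ε` as a functional on `(A ⊗ A) ⊗ A`. -/
noncomputable def r12 (r : A ⊗[ℂ] A →ₗ[ℂ] ℂ) : (A ⊗[ℂ] A) ⊗[ℂ] A →ₗ[ℂ] ℂ :=
  LinearMap.mul' ℂ ℂ ∘ₗ TensorProduct.map r (Coalgebra.counit (R := ℂ))

/-- `r₂₃ = ε ⊗ r` as a functional on `(A ⊗ A) ⊗ A`. -/
noncomputable def r23 (r : A ⊗[ℂ] A →ₗ[ℂ] ℂ) : (A ⊗[ℂ] A) ⊗[ℂ] A →ₗ[ℂ] ℂ :=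
  LinearMap.mul' ℂ ℂ ∘ₗ TensorProduct.map (Coalgebra.counit (R := ℂ)) r
    ∘ₗ (TensorProduct.assoc ℂ A A A).toLinearMap

/-- `r₁₃ = (r ⊗ ε) ∘ (id ⊗ τ)` as a functional on `(A ⊗ A) ⊗ A`. -/
noncomputable def r13 (r : A ⊗[ℂ] A →ₗ[ℂ] ℂ) : (A ⊗[ℂ] A) ⊗[ℂ] A →ₗ[ℂ] ℂ :=
  r ∘ₗ TensorProduct.map
      ((TensorProduct.rid ℂ A).toLinearMap
        ∘ₗ TensorProduct.map LinearMap.id (Coalgebra.counit (R := ℂ)))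
      LinearMap.id

/-- The action `α = (r̄ ⊗ id) ∘ (id ⊗ γ) : A ⊗ V → V` induced by the convolution inverse
`r̄` of a universal R-form and a coaction `γ`. -/
noncomputable def rAction {V : Type*} [AddCommGroup V] [Module ℂ V]
    (rbar : A ⊗[ℂ] A →ₗ[ℂ] ℂ) (γ : V →ₗ[ℂ] A ⊗[ℂ] V) :
    A ⊗[ℂ] V →ₗ[ℂ] V :=
  (TensorProduct.lid ℂ V).toLinearMap
    ∘ₗ TensorProduct.map rbar LinearMap.id
    ∘ₗ (TensorProduct.assoc ℂ A A V).symm.toLinearMap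
    ∘ₗ TensorProduct.map LinearMap.id γ

/-- The left-hand side `(m ⊗ α) ∘ (id ⊗ τ ⊗ id) ∘ (Δ ⊗ γ)` of the compatibility
condition between an action `α` and a coaction `γ`. -/
noncomputable def compatLHS {V : Type*} [AddCommGroup V] [Module ℂ V]
    (α : A ⊗[ℂ] V →ₗ[ℂ] V) (γ : V →ₗ[ℂ] A ⊗[ℂ] V) :
    A ⊗[ℂ] V →ₗ[ℂ] A ⊗[ℂ] V :=
  TensorProduct.map (LinearMap.mul' ℂ A) α
    ∘ₗ (TensorProduct.tensorTensorTensorComm ℂ A A A V).toLinearMap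
    ∘ₗ TensorProduct.map (Coalgebra.comul (R := ℂ)) γ

/-- The right-hand side
`(m ⊗ id) ∘ (id ⊗ τ) ∘ (γ ⊗ id) ∘ (α ⊗ id) ∘ (id ⊗ τ) ∘ (Δ ⊗ id)` of the
compatibility condition between an action `α` and a coaction `γ`. -/
noncomputable def compatRHS {V : Type*} [AddCommGroup V] [Module ℂ V]
    (α : A ⊗[ℂ] V →ₗ[ℂ] V) (γ : V →ₗ[ℂ] A ⊗[ℂ] V) :
    A ⊗[ℂ] V →ₗ[ℂ] A ⊗[ℂ] V :=
  TensorProduct.map (LinearMap.mul' ℂ A) LinearMap.id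
    ∘ₗ (TensorProduct.assoc ℂ A A V).symm.toLinearMap
    ∘ₗ TensorProduct.map LinearMap.id (TensorProduct.comm ℂ V A).toLinearMap
    ∘ₗ (TensorProduct.assoc ℂ A V A).toLinearMap
    ∘ₗ TensorProduct.map γ LinearMap.id
    ∘ₗ TensorProduct.map α LinearMap.id
    ∘ₗ (TensorProduct.assoc ℂ A V A).symm.toLinearMap
    ∘ₗ TensorProduct.map LinearMap.id (TensorProduct.comm ℂ A V).toLinearMap
    ∘ₗ (TensorProduct.assoc ℂ A A V).toLinearMap
    ∘ₗ TensorProduct.map (Coalgebra.comul (R := ℂ)) LinearMap.id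

end Defs

section Helpers

open Coalgebra WithConv

variable {A : Type*} [Ring A] [Bialgebra ℂ A]

theorem toConv_counit2 : toConv (counit2 A) = 1 := by
  apply WithConv.ext
  apply TensorProduct.ext'
  intro a b
  simp [counit2, mul_comm]

theorem toConv_comp_mul_toConv_comp {C D M : Type*} [AddCommGroup C] [Module ℂ C] [Coalgebra ℂ C]
    [AddCommGroup D] [Module ℂ D] [Coalgebra ℂ D] [Ring M] [Algebra ℂ M]
    (h : D →ₗc[ℂ] C) {f g : C →ₗ[ℂ] M} (hfg : toConv f * toConv g = 1) :
    toConv (f ∘ₗ h.toLinearMap) * toConv (g ∘ₗ h.toLinearMap) = 1 := by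
  have key := LinearMap.convMul_comp_coalgHom_distrib (toConv f) (toConv g) h
  rw [hfg] at key
  apply WithConv.ext
  rw [← key]
  ext d
  simp [LinearMap.convOne_def]

/-- The functional `r₁₃` is `r` precomposed with this coalgebra map, `a ⊗ b ⊗ c ↦ ε(b) a ⊗ c`. -/
noncomputable def coalgHom13 (A : Type*) [Ring A] [Bialgebra ℂ A] :
    (A ⊗[ℂ] A) ⊗[ℂ] A →ₗc[ℂ] A ⊗[ℂ] A :=
  Coalgebra.TensorProduct.map
    ((Coalgebra.TensorProduct.rid ℂ ℂ A).toCoalgHom.comp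
      (Coalgebra.TensorProduct.map (CoalgHom.id ℂ A) (counitCoalgHom ℂ A))) (CoalgHom.id ℂ A)

/-- The functional `r₂₃` is `r` precomposed with this coalgebra map, `a ⊗ b ⊗ c ↦ ε(a) b ⊗ c`. -/
noncomputable def coalgHom23 (A : Type*) [Ring A] [Bialgebra ℂ A] :
    (A ⊗[ℂ] A) ⊗[ℂ] A →ₗc[ℂ] A ⊗[ℂ] A :=
  Coalgebra.TensorProduct.map
    ((Coalgebra.TensorProduct.lid ℂ A).toCoalgHom.comp
      (Coalgebra.TensorProduct.map (counitCoalgHom ℂ A) (CoalgHom.id ℂ A))) (CoalgHom.id ℂ A)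

theorem r13_eq_comp (r : A ⊗[ℂ] A →ₗ[ℂ] ℂ) : r13 r = r ∘ₗ (coalgHom13 A).toLinearMap := rfl

theorem r23_eq_comp (r : A ⊗[ℂ] A →ₗ[ℂ] ℂ) : r23 r = r ∘ₗ (coalgHom23 A).toLinearMap := by
  ext a b c
  change counit (R := ℂ) a * r (b ⊗ₜ c) = r ((counit (R := ℂ) a • b) ⊗ₜ c)
  rw [← TensorProduct.smul_tmul', map_smul, smul_eq_mul]

theorem r13_tmul (r : A ⊗[ℂ] A →ₗ[ℂ] ℂ) (a b c : A) :
    r13 r ((a ⊗ₜ b) ⊗ₜ c) = counit (R := ℂ) b * r (a ⊗ₜ c) := by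
  simp [r13, ← TensorProduct.smul_tmul']

theorem r23_tmul (r : A ⊗[ℂ] A →ₗ[ℂ] ℂ) (a b c : A) :
    r23 r ((a ⊗ₜ b) ⊗ₜ c) = counit (R := ℂ) a * r (b ⊗ₜ c) := by
  simp [r23]

theorem r13_conv_r23_tmul (r s : A ⊗[ℂ] A →ₗ[ℂ] ℂ) (a b c : A) :
    (toConv (r13 r) * toConv (r23 s)) ((a ⊗ₜ b) ⊗ₜ c)
      = LinearMap.mul' ℂ ℂ (TensorProduct.map (TensorProduct.curry r a)
          (TensorProduct.curry s b) (comul (R := ℂ) c)) := by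
  have key (x y z : A ⊗[ℂ] A) :
      LinearMap.mul' ℂ ℂ (TensorProduct.map (r13 r) (r23 s)
        (TensorProduct.tensorTensorTensorComm ℂ _ _ _ _
          (TensorProduct.tensorTensorTensorComm ℂ _ _ _ _ (x ⊗ₜ y) ⊗ₜ z)))
      = LinearMap.mul' ℂ ℂ (TensorProduct.map
          (TensorProduct.curry r (TensorProduct.rid ℂ A (counit.lTensor A x)))
          (TensorProduct.curry s (TensorProduct.lid ℂ A (counit.rTensor A y))) z) := by
    induction x with
    | zero => simp
    | add x x' hx hx' => simp [TensorProduct.add_tmul, TensorProduct.map_add_left, hx, hx']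
    | tmul a₁ a₂ =>
    induction y with
    | zero => simp
    | add y y' hy hy' =>
      simp only [TensorProduct.tmul_add, TensorProduct.add_tmul, map_add,
        TensorProduct.map_add_right, LinearMap.add_apply, hy, hy']
    | tmul b₁ b₂ =>
    induction z with
    | zero => simp
    | add z z' hz hz' => simp only [TensorProduct.tmul_add, map_add, hz, hz']
    | tmul c₁ c₂ =>
      simp [r13_tmul, r23_tmul]
      ring
  have := key (comul a) (comul b) (comul c)
  rw [lTensor_counit_comul, rTensor_counit_comul] at this
  simpa [TensorProduct.AlgebraTensorModule.tensorTensorTensorComm_eq] using this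

theorem r23_conv_r13_tmul (r s : A ⊗[ℂ] A →ₗ[ℂ] ℂ) (a b c : A) :
    (toConv (r23 r) * toConv (r13 s)) ((a ⊗ₜ b) ⊗ₜ c)
      = LinearMap.mul' ℂ ℂ (TensorProduct.map (TensorProduct.curry r b)
          (TensorProduct.curry s a) (comul (R := ℂ) c)) := by
  have key (x y z : A ⊗[ℂ] A) :
      LinearMap.mul' ℂ ℂ (TensorProduct.map (r23 r) (r13 s)
        (TensorProduct.tensorTensorTensorComm ℂ _ _ _ _
          (TensorProduct.tensorTensorTensorComm ℂ _ _ _ _ (x ⊗ₜ y) ⊗ₜ z)))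
      = LinearMap.mul' ℂ ℂ (TensorProduct.map
          (TensorProduct.curry r (TensorProduct.rid ℂ A (counit.lTensor A y)))
          (TensorProduct.curry s (TensorProduct.lid ℂ A (counit.rTensor A x))) z) := by
    induction x with
    | zero => simp
    | add x x' hx hx' =>
      simp only [TensorProduct.add_tmul, map_add, TensorProduct.map_add_right,
        LinearMap.add_apply, hx, hx']
    | tmul a₁ a₂ =>
    induction y with
    | zero => simp
    | add y y' hy hy' =>
      simp only [TensorProduct.tmul_add, TensorProduct.add_tmul, map_add,
        TensorProduct.map_add_left, LinearMap.add_apply, hy, hy']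
    | tmul b₁ b₂ =>
    induction z with
    | zero => simp
    | add z z' hz hz' => simp only [TensorProduct.tmul_add, map_add, hz, hz']
    | tmul c₁ c₂ =>
      simp [r13_tmul, r23_tmul]
      ring
  have := key (comul a) (comul b) (comul c)
  rw [lTensor_counit_comul, rTensor_counit_comul] at this
  simpa [TensorProduct.AlgebraTensorModule.tensorTensorTensorComm_eq] using this

/-- The inverse of a universal R-form is antimultiplicative in its first argument. -/
theorem rbar_mul_tmul {r rbar : A ⊗[ℂ] A →ₗ[ℂ] ℂ}
    (h₁ : toConv r * toConv rbar = 1) (h₂ : toConv rbar * toConv r = 1)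
    (hr : toConv (r13 r) * toConv (r23 r)
      = toConv (r ∘ₗ TensorProduct.map (LinearMap.mul' ℂ A) LinearMap.id))
    (a b c : A) :
    rbar ((a * b) ⊗ₜ c) = LinearMap.mul' ℂ ℂ (TensorProduct.map (TensorProduct.curry rbar b)
      (TensorProduct.curry rbar a) (comul (R := ℂ) c)) := by
  let h := Coalgebra.TensorProduct.map (Bialgebra.mulCoalgHom ℂ A) (CoalgHom.id ℂ A)
  have e₁ : toConv (rbar ∘ₗ h.toLinearMap) * toConv (r ∘ₗ h.toLinearMap) = 1 :=
    toConv_comp_mul_toConv_comp h h₂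
  have e₂ : toConv (r ∘ₗ h.toLinearMap) * (toConv (r23 rbar) * toConv (r13 rbar)) = 1 := by
    have : toConv (r ∘ₗ h.toLinearMap) = toConv (r13 r) * toConv (r23 r) := hr.symm
    rw [this, mul_assoc, ← mul_assoc (toConv (r23 r)), r23_eq_comp, r23_eq_comp,
      toConv_comp_mul_toConv_comp _ h₁, one_mul, r13_eq_comp, r13_eq_comp,
      toConv_comp_mul_toConv_comp _ h₁]
  rw [← r23_conv_r13_tmul, ← left_inv_eq_right_inv e₁ e₂]
  simp [h]

/-- The inverse of a universal R-form is counital in its first argument. -/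
theorem rbar_one_tmul {r rbar : A ⊗[ℂ] A →ₗ[ℂ] ℂ}
    (h₁ : toConv r * toConv rbar = 1)
    (hr : toConv (r13 r) * toConv (r23 r)
      = toConv (r ∘ₗ TensorProduct.map (LinearMap.mul' ℂ A) LinearMap.id)) (c : A) :
    rbar (1 ⊗ₜ c) = counit (R := ℂ) c := by
  let u := toConv (TensorProduct.curry r 1)
  let ubar := toConv (TensorProduct.curry rbar 1)
  have e₁ : u * ubar = 1 := by
    apply WithConv.ext
    ext c
    have key (z : A ⊗[ℂ] A) : LinearMap.mul' ℂ ℂ (TensorProduct.map r rbar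
        (TensorProduct.tensorTensorTensorComm ℂ _ _ _ _ ((1 ⊗ₜ 1) ⊗ₜ z)))
        = LinearMap.mul' ℂ ℂ (TensorProduct.map (TensorProduct.curry r 1)
          (TensorProduct.curry rbar 1) z) := by
      induction z with
      | zero => simp
      | add z z' hz hz' => simp only [TensorProduct.tmul_add, map_add, hz, hz']
      | tmul c₁ c₂ => simp
    have := congr($h₁ (1 ⊗ₜ c))
    have hk := key (comul c)
    simp only [LinearMap.convMul_apply, TensorProduct.comul_tmul, Bialgebra.comul_one,
      Algebra.TensorProduct.one_def,
      TensorProduct.AlgebraTensorModule.tensorTensorTensorComm_eq] at this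
    rw [hk] at this
    simpa [u, ubar] using this
  have e₂ : u * u = u := by
    apply WithConv.ext
    ext c
    have := r13_conv_r23_tmul r r 1 1 c
    rw [hr] at this
    simpa [u] using this.symm
  have e₃ : u = 1 := by
    calc u = u * (u * ubar) := by rw [e₁, mul_one]
      _ = 1 := by rw [← mul_assoc, e₂, e₁]
  have e₄ : ubar = 1 := by rw [← e₁, e₃, one_mul]
  simpa [ubar] using congr($e₄ c)

/-- The relation `m ⋆ r̄ = r̄ ⋆ m^op`. -/
theorem mul_conv_rbar {r rbar : A ⊗[ℂ] A →ₗ[ℂ] ℂ}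
    (h₂ : toConv rbar * toConv r = 1)
    (hmop : toConv (Algebra.linearMap ℂ A ∘ₗ r) * toConv (LinearMap.mul' ℂ A)
      * toConv (Algebra.linearMap ℂ A ∘ₗ rbar)
        = toConv (LinearMap.mul' ℂ A ∘ₗ (TensorProduct.comm ℂ A A).toLinearMap)) :
    toConv (LinearMap.mul' ℂ A) * toConv (Algebra.linearMap ℂ A ∘ₗ rbar)
      = toConv (Algebra.linearMap ℂ A ∘ₗ rbar)
        * toConv (LinearMap.mul' ℂ A ∘ₗ (TensorProduct.comm ℂ A A).toLinearMap) := by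
  have e : toConv (Algebra.linearMap ℂ A ∘ₗ rbar) * toConv (Algebra.linearMap ℂ A ∘ₗ r) = 1 := by
    have := LinearMap.algHom_comp_convMul_distrib (Algebra.ofId ℂ A) (toConv rbar) (toConv r)
    rw [h₂] at this
    exact (WithConv.ext this).symm
  rw [← hmop, ← mul_assoc, ← mul_assoc, e, one_mul]

variable {V : Type*} [AddCommGroup V] [Module ℂ V]

theorem rAction_tmul (rbar : A ⊗[ℂ] A →ₗ[ℂ] ℂ) (γ : V →ₗ[ℂ] A ⊗[ℂ] V) (a : A) (v : V) :
    rAction rbar γ (a ⊗ₜ v) = TensorProduct.lid ℂ V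
      (TensorProduct.map (TensorProduct.curry rbar a) LinearMap.id (γ v)) := by
  simp only [rAction, LinearMap.comp_apply, LinearEquiv.coe_coe, TensorProduct.map_tmul,
    LinearMap.id_apply]
  induction γ v with
  | zero => simp
  | add t t' ht ht' => simp only [TensorProduct.tmul_add, map_add, ht, ht']
  | tmul c w => simp

theorem rAction_rAction (rbar : A ⊗[ℂ] A →ₗ[ℂ] ℂ) (γ : V →ₗ[ℂ] A ⊗[ℂ] V)
    (hγ : ∀ v : V, TensorProduct.map LinearMap.id γ (γ v)
      = TensorProduct.assoc ℂ A A V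
          (TensorProduct.map (comul (R := ℂ)) LinearMap.id (γ v))) (a b : A) (v : V) :
    rAction rbar γ (a ⊗ₜ rAction rbar γ (b ⊗ₜ v))
      = TensorProduct.lid ℂ V (TensorProduct.map (LinearMap.mul' ℂ ℂ ∘ₗ
          TensorProduct.map (TensorProduct.curry rbar b)
            (TensorProduct.curry rbar a) ∘ₗ comul (R := ℂ)) LinearMap.id (γ v)) := by
  let F : A ⊗[ℂ] (A ⊗[ℂ] V) →ₗ[ℂ] V := (TensorProduct.lid ℂ V).toLinearMap
    ∘ₗ TensorProduct.map (TensorProduct.curry rbar b) ((TensorProduct.lid ℂ V).toLinearMap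
      ∘ₗ TensorProduct.map (TensorProduct.curry rbar a) LinearMap.id)
  have h₁ (t : A ⊗[ℂ] V) : rAction rbar γ (a ⊗ₜ TensorProduct.lid ℂ V
      (TensorProduct.map (TensorProduct.curry rbar b) LinearMap.id t))
      = F (TensorProduct.map LinearMap.id γ t) := by
    induction t with
    | zero => simp
    | add t t' ht ht' => simp only [TensorProduct.tmul_add, map_add, ht, ht']
    | tmul c w => simp [F, rAction_tmul]
  have h₂ (w : V) (y : A ⊗[ℂ] A) : F (TensorProduct.assoc ℂ A A V (y ⊗ₜ w))
      = LinearMap.mul' ℂ ℂ (TensorProduct.map (TensorProduct.curry rbar b)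
            (TensorProduct.curry rbar a) y) • w := by
    induction y with
    | zero => simp
    | add y y' hy hy' => simp only [TensorProduct.add_tmul, map_add, hy, hy', add_smul]
    | tmul c d =>
      simpa [F, mul_smul] using smul_comm _ _ _
  rw [rAction_tmul rbar γ b, h₁, hγ]
  induction γ v with
  | zero => simp
  | add t t' ht ht' => simp only [map_add, ht, ht']
  | tmul c w => simp [h₂]

theorem compatLHS_rAction_tmul (rbar : A ⊗[ℂ] A →ₗ[ℂ] ℂ) (γ : V →ₗ[ℂ] A ⊗[ℂ] V)
    (hγ : ∀ v : V, TensorProduct.map LinearMap.id γ (γ v)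
      = TensorProduct.assoc ℂ A A V
          (TensorProduct.map (comul (R := ℂ)) LinearMap.id (γ v))) (a : A) (v : V) :
    compatLHS (rAction rbar γ) γ (a ⊗ₜ v)
      = TensorProduct.map (toConv (LinearMap.mul' ℂ A)
          * toConv (Algebra.linearMap ℂ A ∘ₗ rbar)).ofConv LinearMap.id
          ((TensorProduct.assoc ℂ A A V).symm (a ⊗ₜ γ v)) := by
  let κ : A ⊗[ℂ] (A ⊗[ℂ] V) →ₗ[ℂ] V := (TensorProduct.lid ℂ V).toLinearMap
    ∘ₗ TensorProduct.map rbar LinearMap.id ∘ₗ (TensorProduct.assoc ℂ A A V).symm.toLinearMap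
  let G : (A ⊗[ℂ] A) ⊗[ℂ] (A ⊗[ℂ] (A ⊗[ℂ] V)) →ₗ[ℂ] A ⊗[ℂ] V :=
    TensorProduct.map (LinearMap.mul' ℂ A) κ
      ∘ₗ (TensorProduct.tensorTensorTensorComm ℂ A A A (A ⊗[ℂ] V)).toLinearMap
  have h₁ (x : A ⊗[ℂ] A) (t : A ⊗[ℂ] V) :
      TensorProduct.map (LinearMap.mul' ℂ A) (rAction rbar γ)
        (TensorProduct.tensorTensorTensorComm ℂ A A A V (x ⊗ₜ t))
      = G (x ⊗ₜ TensorProduct.map LinearMap.id γ t) := by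
    induction x with
    | zero => simp
    | add x x' hx hx' => simp only [TensorProduct.add_tmul, map_add, hx, hx']
    | tmul a₁ a₂ =>
    induction t with
    | zero => simp
    | add t t' ht ht' => simp only [TensorProduct.tmul_add, map_add, ht, ht']
    | tmul c w => simp [G, κ, rAction]
  have h₂ (w : V) (x y : A ⊗[ℂ] A) : G (x ⊗ₜ TensorProduct.assoc ℂ A A V (y ⊗ₜ w))
      = LinearMap.mul' ℂ A (TensorProduct.map (LinearMap.mul' ℂ A)
          (Algebra.linearMap ℂ A ∘ₗ rbar)
          (TensorProduct.tensorTensorTensorComm ℂ A A A A (x ⊗ₜ y))) ⊗ₜ w := by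
    induction x with
    | zero => simp
    | add x x' hx hx' => simp only [TensorProduct.add_tmul, map_add, hx, hx']
    | tmul a₁ a₂ =>
    induction y with
    | zero => simp
    | add y y' hy hy' =>
      simp only [TensorProduct.add_tmul, TensorProduct.tmul_add, map_add, hy, hy']
    | tmul c d =>
      simp [G, κ, ← Algebra.commutes, ← Algebra.smul_def, TensorProduct.smul_tmul']
  have h₃ : compatLHS (rAction rbar γ) γ (a ⊗ₜ v)
      = G (comul a ⊗ₜ TensorProduct.map LinearMap.id γ (γ v)) := h₁ _ _
  rw [h₃, hγ]
  induction γ v with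
  | zero => simp
  | add t t' ht ht' => simp only [map_add, TensorProduct.tmul_add, ht, ht']
  | tmul c w =>
    simp [h₂, TensorProduct.AlgebraTensorModule.tensorTensorTensorComm_eq]

theorem compatRHS_rAction_tmul (rbar : A ⊗[ℂ] A →ₗ[ℂ] ℂ) (γ : V →ₗ[ℂ] A ⊗[ℂ] V)
    (hγ : ∀ v : V, TensorProduct.map LinearMap.id γ (γ v)
      = TensorProduct.assoc ℂ A A V
          (TensorProduct.map (comul (R := ℂ)) LinearMap.id (γ v))) (a : A) (v : V) :
    compatRHS (rAction rbar γ) γ (a ⊗ₜ v)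
      = TensorProduct.map (toConv (Algebra.linearMap ℂ A ∘ₗ rbar)
          * toConv (LinearMap.mul' ℂ A ∘ₗ (TensorProduct.comm ℂ A A).toLinearMap)).ofConv
          LinearMap.id ((TensorProduct.assoc ℂ A A V).symm (a ⊗ₜ γ v)) := by
  let H : (A ⊗[ℂ] V) ⊗[ℂ] A →ₗ[ℂ] A ⊗[ℂ] V :=
    TensorProduct.map (LinearMap.mul' ℂ A) LinearMap.id
      ∘ₗ (TensorProduct.assoc ℂ A A V).symm.toLinearMap
      ∘ₗ TensorProduct.map LinearMap.id (TensorProduct.comm ℂ V A).toLinearMap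
      ∘ₗ (TensorProduct.assoc ℂ A V A).toLinearMap
  let K : A ⊗[ℂ] (A ⊗[ℂ] (A ⊗[ℂ] V)) →ₗ[ℂ] A ⊗[ℂ] V :=
    (TensorProduct.lid ℂ (A ⊗[ℂ] V)).toLinearMap ∘ₗ TensorProduct.map rbar LinearMap.id
      ∘ₗ (TensorProduct.assoc ℂ A A (A ⊗[ℂ] V)).symm.toLinearMap
  let L : (A ⊗[ℂ] A) ⊗[ℂ] (A ⊗[ℂ] (A ⊗[ℂ] V)) →ₗ[ℂ] A ⊗[ℂ] V :=
    H ∘ₗ TensorProduct.map K LinearMap.id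
      ∘ₗ (TensorProduct.assoc ℂ A (A ⊗[ℂ] (A ⊗[ℂ] V)) A).symm.toLinearMap
      ∘ₗ TensorProduct.map LinearMap.id
        (TensorProduct.comm ℂ A (A ⊗[ℂ] (A ⊗[ℂ] V))).toLinearMap
      ∘ₗ (TensorProduct.assoc ℂ A A (A ⊗[ℂ] (A ⊗[ℂ] V))).toLinearMap
  have h₀ (b : A) (t : A ⊗[ℂ] V) : γ (TensorProduct.lid ℂ V
      (TensorProduct.map (TensorProduct.curry rbar b) LinearMap.id t))
      = K (b ⊗ₜ TensorProduct.map LinearMap.id γ t) := by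
    induction t with
    | zero => simp
    | add t t' ht ht' => simp only [TensorProduct.tmul_add, map_add, ht, ht']
    | tmul c w => simp [K]
  have h₁ (x : A ⊗[ℂ] A) :
      H (TensorProduct.map γ LinearMap.id (TensorProduct.map (rAction rbar γ) LinearMap.id
        ((TensorProduct.assoc ℂ A V A).symm (TensorProduct.map LinearMap.id
          (TensorProduct.comm ℂ A V).toLinearMap (TensorProduct.assoc ℂ A A V (x ⊗ₜ v))))))
      = L (x ⊗ₜ TensorProduct.map LinearMap.id γ (γ v)) := by
    induction x with
    | zero => simp
    | add x x' hx hx' => simp only [TensorProduct.add_tmul, map_add, hx, hx']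
    | tmul a₁ a₂ => simp [L, rAction_tmul, h₀]
  have h₂ (w : V) (x y : A ⊗[ℂ] A) : L (x ⊗ₜ TensorProduct.assoc ℂ A A V (y ⊗ₜ w))
      = LinearMap.mul' ℂ A (TensorProduct.map (Algebra.linearMap ℂ A ∘ₗ rbar)
          (LinearMap.mul' ℂ A ∘ₗ (TensorProduct.comm ℂ A A).toLinearMap)
          (TensorProduct.tensorTensorTensorComm ℂ A A A A (x ⊗ₜ y))) ⊗ₜ w := by
    induction x with
    | zero => simp
    | add x x' hx hx' => simp only [TensorProduct.add_tmul, map_add, hx, hx']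
    | tmul a₁ a₂ =>
    induction y with
    | zero => simp
    | add y y' hy hy' =>
      simp only [TensorProduct.add_tmul, TensorProduct.tmul_add, map_add, hy, hy']
    | tmul c d =>
      simp [L, H, K, ← Algebra.smul_def, TensorProduct.smul_tmul']
  have h₃ : compatRHS (rAction rbar γ) γ (a ⊗ₜ v)
      = L (comul a ⊗ₜ TensorProduct.map LinearMap.id γ (γ v)) := h₁ _
  rw [h₃, hγ]
  induction γ v with
  | zero => simp
  | add t t' ht ht' => simp only [map_add, TensorProduct.tmul_add, ht, ht']
  | tmul c w =>
    simp [h₂, TensorProduct.AlgebraTensorModule.tensorTensorTensorComm_eq]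

theorem comp_rAction {W : Type*} [AddCommGroup W] [Module ℂ W] (rbar : A ⊗[ℂ] A →ₗ[ℂ] ℂ)
    (γ : V →ₗ[ℂ] A ⊗[ℂ] V) (γW : W →ₗ[ℂ] A ⊗[ℂ] W) (f : V →ₗ[ℂ] W)
    (hf : γW ∘ₗ f = TensorProduct.map LinearMap.id f ∘ₗ γ) :
    f ∘ₗ rAction rbar γ = rAction rbar γW ∘ₗ TensorProduct.map LinearMap.id f := by
  apply TensorProduct.ext'
  intro a v
  have hfv : γW (f v) = TensorProduct.map LinearMap.id f (γ v) := congr($hf v)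
  simp only [LinearMap.comp_apply, TensorProduct.map_tmul, LinearMap.id_apply, rAction_tmul, hfv]
  induction γ v with
  | zero => simp
  | add t t' ht ht' => simp only [map_add, ht, ht']
  | tmul c w => simp

end Helpers

/-- For a bialgebra `A` with a universal R-form `r` (with convolution inverse `r̄`)
and a left coaction `γ` of `A` on `V`:
(1) `α = (r̄ ⊗ id) ∘ (id ⊗ γ)` is a left action of `A` on `V`;
(2) `α` and `γ` satisfy the compatibility condition;
(3) every comodule map `f : V → W` is a module map for the induced actions. -/
theorem rForm_coaction_induces_compatible_action
    {A : Type*} [Ring A] [Bialgebra ℂ A]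
    (r rbar : A ⊗[ℂ] A →ₗ[ℂ] ℂ)
    (hrinv : convWith (Delta2 A) r rbar = counit2 A ∧
      convWith (Delta2 A) rbar r = counit2 A)
    (hmop : convWith (Delta2 A) (convWith (Delta2 A)
          ((Algebra.linearMap ℂ A) ∘ₗ r) (LinearMap.mul' ℂ A))
          ((Algebra.linearMap ℂ A) ∘ₗ rbar)
        = LinearMap.mul' ℂ A ∘ₗ (TensorProduct.comm ℂ A A).toLinearMap)
    (hr1323 : convWith (Delta3 A) (r13 r) (r23 r)
        = r ∘ₗ TensorProduct.map (LinearMap.mul' ℂ A) LinearMap.id)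
    (hr1312 : convWith (Delta3 A) (r13 r) (r12 r)
        = r ∘ₗ TensorProduct.map LinearMap.id (LinearMap.mul' ℂ A)
            ∘ₗ (TensorProduct.assoc ℂ A A A).toLinearMap)
    {V : Type*} [AddCommGroup V] [Module ℂ V]
    (γ : V →ₗ[ℂ] A ⊗[ℂ] V)
    (hγcounit : ∀ v : V,
      (TensorProduct.lid ℂ V)
        (TensorProduct.map (Coalgebra.counit (R := ℂ)) LinearMap.id (γ v)) = v)
    (hγcoassoc : ∀ v : V,
      TensorProduct.map LinearMap.id γ (γ v)
        = TensorProduct.assoc ℂ A A V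
            (TensorProduct.map (Coalgebra.comul (R := ℂ)) LinearMap.id (γ v)))
    {W : Type*} [AddCommGroup W] [Module ℂ W]
    (γW : W →ₗ[ℂ] A ⊗[ℂ] W)
    (hγWcounit : ∀ w : W,
      (TensorProduct.lid ℂ W)
        (TensorProduct.map (Coalgebra.counit (R := ℂ)) LinearMap.id (γW w)) = w)
    (hγWcoassoc : ∀ w : W,
      TensorProduct.map LinearMap.id γW (γW w)
        = TensorProduct.assoc ℂ A A W
            (TensorProduct.map (Coalgebra.comul (R := ℂ)) LinearMap.id (γW w)))
    (f : V →ₗ[ℂ] W)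
    (hf : γW ∘ₗ f = TensorProduct.map LinearMap.id f ∘ₗ γ) :
    ((∀ v : V, rAction rbar γ ((1 : A) ⊗ₜ[ℂ] v) = v) ∧
      (∀ (a b : A) (v : V),
        rAction rbar γ ((a * b) ⊗ₜ[ℂ] v)
          = rAction rbar γ (a ⊗ₜ[ℂ] rAction rbar γ (b ⊗ₜ[ℂ] v)))) ∧
    compatLHS (rAction rbar γ) γ = compatRHS (rAction rbar γ) γ ∧
    f ∘ₗ rAction rbar γ = rAction rbar γW ∘ₗ TensorProduct.map LinearMap.id f := by
  have h₁ : WithConv.toConv r * WithConv.toConv rbar = 1 := by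
    rw [← toConv_counit2, ← hrinv.1]; rfl
  have h₂ : WithConv.toConv rbar * WithConv.toConv r = 1 := by
    rw [← toConv_counit2, ← hrinv.2]; rfl
  have hr : WithConv.toConv (r13 r) * WithConv.toConv (r23 r)
      = WithConv.toConv (r ∘ₗ TensorProduct.map (LinearMap.mul' ℂ A) LinearMap.id) :=
    WithConv.ext hr1323
  refine ⟨⟨fun v => ?_, fun a b v => ?_⟩, ?_, comp_rAction rbar γ γW f hf⟩
  · have h : TensorProduct.curry rbar 1 = Coalgebra.counit (R := ℂ) := by
      ext c
      exact rbar_one_tmul h₁ hr c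
    rw [rAction_tmul, h, hγcounit]
  · have h : TensorProduct.curry rbar (a * b) = LinearMap.mul' ℂ ℂ ∘ₗ
        TensorProduct.map (TensorProduct.curry rbar b) (TensorProduct.curry rbar a)
          ∘ₗ Coalgebra.comul (R := ℂ) := by
      ext c
      exact rbar_mul_tmul h₁ h₂ hr a b c
    rw [rAction_rAction rbar γ hγcoassoc, rAction_tmul, h]
  · apply TensorProduct.ext'
    intro a v
    rw [compatLHS_rAction_tmul rbar γ hγcoassoc, compatRHS_rAction_tmul rbar γ hγcoassoc,
      mul_conv_rbar h₂ (WithConv.ext hmop)]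
end
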